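/- arXiv:1904.12804 — 4 statements merged into one kernel-verified Lean document; each statement's English description precedes it below -/
import Mathlib

section
/- Let a_1, a_2, b_1, b_2 be nonnegative real numbers such that b_1 = 0 implies a_1 = 0, b_2 = 0 implies a_2 = 0, and a_1/√b_1 ≥ a_2/√b_2. Then a_1/√b_1 + a_2/(2·√b_2) ≥ (a_1 + a_2)/√(b_1 + b_2). -/
/-- Two-term inductive step: for nonnegative reals with `b_k = 0 → a_k = 0` and
`a_1/√b_1 ≥ a_2/√b_2`, we have `a_1/√b_1 + a_2/(2√b_2) ≥ (a_1+a_2)/√(b_1+b_2)`. -/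
theorem stmt_1 (a₁ a₂ b₁ b₂ : ℝ)
    (ha₁ : 0 ≤ a₁) (ha₂ : 0 ≤ a₂) (hb₁ : 0 ≤ b₁) (hb₂ : 0 ≤ b₂)
    (h₁ : b₁ = 0 → a₁ = 0) (h₂ : b₂ = 0 → a₂ = 0)
    (hord : a₂ / Real.sqrt b₂ ≤ a₁ / Real.sqrt b₁) :
    a₁ / Real.sqrt b₁ + a₂ / (2 * Real.sqrt b₂)
      ≥ (a₁ + a₂) / Real.sqrt (b₁ + b₂) := by
  have hs := Real.sqrt_nonneg b₁
  have ht := Real.sqrt_nonneg b₂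
  have hr := Real.sqrt_nonneg (b₁ + b₂)
  have hr2 : √(b₁ + b₂) ^ 2 = √b₁ ^ 2 + √b₂ ^ 2 := by
    rw [Real.sq_sqrt hb₁, Real.sq_sqrt hb₂, Real.sq_sqrt (add_nonneg hb₁ hb₂)]
  have hu : a₁ / √b₁ * √b₁ = a₁ :=
    div_mul_cancel_of_imp fun h => h₁ ((Real.sqrt_eq_zero hb₁).1 h)
  have hv : a₂ / √b₂ * √b₂ = a₂ :=
    div_mul_cancel_of_imp fun h => h₂ ((Real.sqrt_eq_zero hb₂).1 h)
  have hv0 : 0 ≤ a₂ / √b₂ := by positivity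
  have hsr : √b₁ ≤ √(b₁ + b₂) := Real.sqrt_le_sqrt (by linarith)
  have hstr : √b₁ + √b₂ ≤ 3 / 2 * √(b₁ + b₂) :=
    abs_le_of_sq_le_sq' (by nlinarith [sq_nonneg (√b₁ - √b₂)]) (by positivity) |>.2
  refine div_le_of_le_mul₀ hr (by positivity) ?_
  have hhalf : a₂ / (2 * √b₂) = a₂ / √b₂ / 2 := by rw [mul_comm, div_mul_eq_div_div]
  rw [hhalf]
  linarith [mul_le_mul_of_nonneg_right hord (sub_nonneg.2 hsr),
    mul_le_mul_of_nonneg_left hstr hv0]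
end

section
/- Let M and z be real numbers with M > 0 and z > 0. Then z − M/2 + min(2M, M^{3/2}/√z) ≥ (2^{−2/3} + 2^{1/3} − 1/2)·M; in particular, z − M/2 + min(2M, M^{3/2}/√z) ≥ 1.38988157484·M. -/
lemma three_mul_mul_sq_le_cube_add (s u : ℝ) (hs : 0 ≤ s) (hu : 0 ≤ u) :
    3 * s * u ^ 2 ≤ s ^ 3 + 2 * u ^ 3 := by
  have h : 0 ≤ (s - u) ^ 2 * (s + 2 * u) := by positivity
  linarith [show (s - u) ^ 2 * (s + 2 * u) = s ^ 3 + 2 * u ^ 3 - 3 * s * u ^ 2 by ring]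

lemma two_rpow_third_pow_three : ((2 : ℝ) ^ ((1 : ℝ) / 3)) ^ 3 = 2 := by
  rw [← Real.rpow_natCast, ← Real.rpow_mul (by norm_num)]
  norm_num

lemma two_rpow_neg_two_thirds : (2 : ℝ) ^ (-(2 : ℝ) / 3) = (2 : ℝ) ^ ((1 : ℝ) / 3) / 2 := by
  rw [← Real.rpow_sub_one (by norm_num)]
  norm_num

lemma rpow_three_halves_eq_sqrt_pow (M : ℝ) (hM : 0 ≤ M) :
    M ^ ((3 : ℝ) / 2) = Real.sqrt M ^ 3 := by
  rw [Real.sqrt_eq_rpow, ← Real.rpow_natCast, ← Real.rpow_mul hM]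
  norm_num

lemma mul_le_add_rpow_div_sqrt (M z c : ℝ) (hM : 0 ≤ M) (hz : 0 < z)
    (hc3 : c ^ 3 = 2) : 3 * c / 2 * M ≤ z + M ^ ((3 : ℝ) / 2) / Real.sqrt z := by
  rw [rpow_three_halves_eq_sqrt_pow M hM]
  have hs : 0 < Real.sqrt z := Real.sqrt_pos.2 hz
  have hz2 : Real.sqrt z ^ 2 = z := Real.sq_sqrt hz.le
  have hM2 : Real.sqrt M ^ 2 = M := Real.sq_sqrt hM
  have ht : 0 ≤ Real.sqrt M := Real.sqrt_nonneg M
  generalize Real.sqrt z = s at *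
  generalize Real.sqrt M = t at *
  subst hz2 hM2
  have h := three_mul_mul_sq_le_cube_add s (t * c ^ 2 / 2) hs.le (by positivity)
  have h2 : (t * c ^ 2 / 2) ^ 2 = t ^ 2 * c / 2 := by
    linear_combination t ^ 2 * c / 4 * hc3
  have h3 : (t * c ^ 2 / 2) ^ 3 = t ^ 3 / 2 := by
    linear_combination t ^ 3 / 8 * (c ^ 3 + 2) * hc3
  rw [h2, h3] at h
  rw [← sub_le_iff_le_add', le_div_iff₀ hs]
  linarith

/-- Minimization step: for `M > 0` and `z > 0`,
`z − M/2 + min(2M, M^{3/2}/√z) ≥ (2^{−2/3} + 2^{1/3} − 1/2)·M ≥ 1.38988157484·M`. -/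
theorem stmt_4 (M z : ℝ) (hM : 0 < M) (hz : 0 < z) :
    z - M / 2 + min (2 * M) (M ^ ((3 : ℝ) / 2) / Real.sqrt z)
        ≥ ((2 : ℝ) ^ (-(2 : ℝ) / 3) + (2 : ℝ) ^ ((1 : ℝ) / 3) - 1 / 2) * M
      ∧ z - M / 2 + min (2 * M) (M ^ ((3 : ℝ) / 2) / Real.sqrt z)
        ≥ 1.38988157484 * M := by
  rw [two_rpow_neg_two_thirds]
  have hc3 := two_rpow_third_pow_three
  have hc : 0 ≤ (2 : ℝ) ^ ((1 : ℝ) / 3) := by positivity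
  generalize (2 : ℝ) ^ ((1 : ℝ) / 3) = c at *
  have upper : c ≤ 4 / 3 := le_of_pow_le_pow_left₀ three_ne_zero (by norm_num) (by
    rw [hc3]; norm_num)
  have lower : 1.259921049894 ≤ c := le_of_pow_le_pow_left₀ three_ne_zero hc (by
    rw [hc3]; norm_num)
  have main : z - M / 2 + min (2 * M) (M ^ ((3 : ℝ) / 2) / Real.sqrt z)
      ≥ (c / 2 + c - 1 / 2) * M := by
    rcases min_choice (2 * M) (M ^ ((3 : ℝ) / 2) / Real.sqrt z) with h | h <;> rw [h]
    · linarith [mul_le_mul_of_nonneg_right upper hM.le]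
    · linarith [mul_le_add_rpow_div_sqrt M z c hM.le hz hc3]
  refine ⟨main, le_trans ?_ main⟩
  gcongr
  linarith
end

section
/- Let F be a finite field, let n ≥ 1, and consider the matrix multiplication map sending a pair (A, B) of n×n matrices over F to their product A·B. Let X₁ be any set of positions of input entries (i.e., a subset of the disjoint union of the n² entry positions of A and the n² entry positions of B) with |X₁| = u, and let Y₁ be any set of output entry positions (a subset of the n² entry positions of the product) with |Y₁| = v. Then there exists an assignment φ of values in F to all input positions outside X₁ such that the map which takes an assignment x : X₁ → F of the remaining input entries to the restriction to Y₁ of the product of the resulting matrices has image of cardinality at least |F|^{(1/2)·(v − (2n² − u)²/(4n²))}, where the exponent is a real number and the inequality is between reals. -/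
/-- If every target pattern on `S ⊆ Y` is attained by `f`, then the image of `f` has at least
`|F| ^ |S|` points. -/
theorem card_pow_le_card_range {F α β : Type*} [Fintype F] [Nonempty F] {Y S : Finset β}
    (f : α → {e // e ∈ Y} → F) (hSY : S ⊆ Y)
    (hf : ∀ t : β → F, ∃ x, ∀ q (hq : q ∈ S), f x ⟨q, hSY hq⟩ = t q) :
    Fintype.card F ^ S.card ≤ Nat.card (Set.range f) := by
  classical
  obtain ⟨a₀⟩ := ‹Nonempty F›
  choose x hx using hf
  let extend : ({q // q ∈ S} → F) → β → F := fun t q => if h : q ∈ S then t ⟨q, h⟩ else a₀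
  let φ : ({q // q ∈ S} → F) → Set.range f := fun t => ⟨f (x (extend t)), x (extend t), rfl⟩
  have hφ : Function.Injective φ := by
    intro t s hts
    funext q
    have h := congrFun (congrArg Subtype.val hts) ⟨q.1, hSY q.2⟩
    simpa [φ, hx _ _ q.2, extend] using h
  have : Finite (Set.range f) := Set.toFinite _
  simpa [Nat.card_eq_fintype_card] using Nat.card_le_card_of_injective φ hφ

/-- The outputs indexed by `Y`, as a function of the inputs indexed by `X`, of the product of two
`n × n` matrices whose remaining entries are given by `φ`. -/
def mulSubfunction {F : Type*} [Field F] {n : ℕ}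
    (X : Finset ((Fin n × Fin n) ⊕ (Fin n × Fin n))) (Y : Finset (Fin n × Fin n))
    (φ : ((Fin n × Fin n) ⊕ (Fin n × Fin n)) → F) (x : {p // p ∈ X} → F)
    (q : {e // e ∈ Y}) : F :=
  let g : ((Fin n × Fin n) ⊕ (Fin n × Fin n)) → F :=
    fun p => if h : p ∈ X then x ⟨p, h⟩ else φ p
  let A : Matrix (Fin n) (Fin n) F := fun r c => g (Sum.inl (r, c))
  let B : Matrix (Fin n) (Fin n) F := fun r c => g (Sum.inr (r, c))
  (A * B) q.1.1 q.1.2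

theorem mulSubfunction_restrict {F : Type*} [Field F] {n : ℕ}
    {X : Finset ((Fin n × Fin n) ⊕ (Fin n × Fin n))} {Y : Finset (Fin n × Fin n)}
    {φ G : ((Fin n × Fin n) ⊕ (Fin n × Fin n)) → F} (hG : ∀ p ∉ X, G p = φ p)
    (q : {e // e ∈ Y}) :
    mulSubfunction X Y φ (fun p => G p) q =
      ∑ c, G (Sum.inl (q.1.1, c)) * G (Sum.inr (c, q.1.2)) := by
  have h : (fun p => if _h : p ∈ X then G p else φ p) = G := by
    funext p
    by_cases hp : p ∈ X
    · simp [hp]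
    · simp [hp, hG p hp]
  exact Matrix.mul_apply.trans <| Finset.sum_congr rfl fun c _ =>
    congrArg₂ (· * ·) (congrFun h _) (congrFun h _)

/-- Fixing the left factor to be a cyclic shift. -/
theorem exists_pow_card_right_le {F : Type*} [Field F] [Fintype F] {n : ℕ} [NeZero n]
    (X : Finset ((Fin n × Fin n) ⊕ (Fin n × Fin n))) (Y : Finset (Fin n × Fin n)) (k : Fin n) :
    ∃ φ : ((Fin n × Fin n) ⊕ (Fin n × Fin n)) → F,
      Fintype.card F ^ (Y.filter fun q => Sum.inr (q.1 + k, q.2) ∈ X).card ≤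
        Nat.card (Set.range (mulSubfunction X Y φ)) := by
  refine ⟨Sum.elim (fun p => if p.2 = p.1 + k then 1 else 0) 0,
    card_pow_le_card_range _ (Finset.filter_subset _ _) fun t => ?_⟩
  let G : ((Fin n × Fin n) ⊕ (Fin n × Fin n)) → F :=
    Sum.elim (fun p => if p.2 = p.1 + k then 1 else 0)
      (fun p => if Sum.inr p ∈ X then t (p.1 - k, p.2) else 0)
  refine ⟨fun p => G p, fun q hq => ?_⟩
  rw [mulSubfunction_restrict]
  · rw [Finset.sum_eq_single (q.1 + k) (fun c _ hc => by simp [G, hc]) (by simp)]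
    simp [G, (Finset.mem_filter.1 hq).2]
  · rintro (p | p) hp <;> simp [G, hp]

/-- Fixing the right factor to be a cyclic shift. -/
theorem exists_pow_card_left_le {F : Type*} [Field F] [Fintype F] {n : ℕ} [NeZero n]
    (X : Finset ((Fin n × Fin n) ⊕ (Fin n × Fin n))) (Y : Finset (Fin n × Fin n)) (k : Fin n) :
    ∃ φ : ((Fin n × Fin n) ⊕ (Fin n × Fin n)) → F,
      Fintype.card F ^ (Y.filter fun q => Sum.inl (q.1, q.2 + k) ∈ X).card ≤
        Nat.card (Set.range (mulSubfunction X Y φ)) := by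
  refine ⟨Sum.elim 0 (fun p => if p.1 = p.2 + k then 1 else 0),
    card_pow_le_card_range _ (Finset.filter_subset _ _) fun t => ?_⟩
  let G : ((Fin n × Fin n) ⊕ (Fin n × Fin n)) → F :=
    Sum.elim (fun p => if Sum.inl p ∈ X then t (p.1, p.2 - k) else 0)
      (fun p => if p.1 = p.2 + k then 1 else 0)
  refine ⟨fun p => G p, fun q hq => ?_⟩
  rw [mulSubfunction_restrict]
  · rw [Finset.sum_eq_single (q.2 + k) (fun c _ hc => by simp [G, hc]) (by simp)]
    simp [G, (Finset.mem_filter.1 hq).2]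
  · rintro (p | p) hp <;> simp [G, hp]

theorem sum_add_ge_of_le {n : ℕ} (hn : 1 ≤ n) (p q : Fin n → ℝ) (hp₀ : ∀ i, 0 ≤ p i)
    (hp : ∀ i, p i ≤ n) (hq₀ : ∀ j, 0 ≤ q j) (hq : ∀ j, q j ≤ n) (Y : Finset (Fin n × Fin n)) :
    (n : ℝ) * (Y.card - (2 * (n : ℝ) ^ 2 - (∑ i, p i + ∑ j, q j)) ^ 2 / (4 * (n : ℝ) ^ 2)) ≤
      ∑ e ∈ Y, (p e.1 + q e.2) := by
  have hn' : (0 : ℝ) < n := by exact_mod_cast hn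
  have hnonneg (e : Fin n × Fin n) : 0 ≤ (n - p e.1) * (n - q e.2) :=
    mul_nonneg (sub_nonneg.2 (hp _)) (sub_nonneg.2 (hq _))
  have hprod : ∑ e : Fin n × Fin n, ((n : ℝ) - p e.1) * (n - q e.2) =
      ((n : ℝ) ^ 2 - ∑ i, p i) * ((n : ℝ) ^ 2 - ∑ j, q j) := by
    rw [Fintype.sum_prod_type]
    dsimp only
    rw [← Fintype.sum_mul_sum]
    simp [Finset.sum_sub_distrib, sq]
  have hle : ∑ e ∈ Y, ((n : ℝ) - p e.1) * (n - q e.2) ≤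
      ((n : ℝ) ^ 2 - ∑ i, p i) * ((n : ℝ) ^ 2 - ∑ j, q j) :=
    hprod ▸ Finset.sum_le_univ_sum_of_nonneg hnonneg
  have hlow : ∑ e ∈ Y, ((n : ℝ) ^ 2 - (n - p e.1) * (n - q e.2)) ≤
      ∑ e ∈ Y, n * (p e.1 + q e.2) := by
    refine Finset.sum_le_sum fun e _ => ?_
    nlinarith [mul_nonneg (hp₀ e.1) (hq₀ e.2)]
  rw [Finset.sum_sub_distrib, ← Finset.mul_sum, Finset.sum_const, nsmul_eq_mul] at hlow
  refine le_of_mul_le_mul_left ?_ hn'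
  have heq : (n : ℝ) * (n * (Y.card -
      (2 * (n : ℝ) ^ 2 - (∑ i, p i + ∑ j, q j)) ^ 2 / (4 * (n : ℝ) ^ 2))) =
      Y.card * (n : ℝ) ^ 2 - (2 * (n : ℝ) ^ 2 - (∑ i, p i + ∑ j, q j)) ^ 2 / 4 := by
    field_simp
  rw [heq]
  nlinarith [sq_nonneg (∑ i, p i - ∑ j, q j)]

/-- Averaging over all cyclic shifts. -/
theorem exists_shift_card_ge {n : ℕ} [NeZero n]
    (X : Finset ((Fin n × Fin n) ⊕ (Fin n × Fin n))) (Y : Finset (Fin n × Fin n)) :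
    ∃ k : Fin n, ∃ s : ℕ,
      (1 / 2 : ℝ) * ((Y.card : ℝ) -
        (2 * (n : ℝ) ^ 2 - (X.card : ℝ)) ^ 2 / (4 * (n : ℝ) ^ 2)) ≤ s ∧
      (s = (Y.filter fun q => Sum.inl (q.1, q.2 + k) ∈ X).card ∨
        s = (Y.filter fun q => Sum.inr (q.1 + k, q.2) ∈ X).card) := by
  classical
  let p : Fin n → ℝ := fun i => ∑ c, if Sum.inl (i, c) ∈ X then 1 else 0
  let q : Fin n → ℝ := fun j => ∑ r, if Sum.inr (r, j) ∈ X then 1 else 0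
  have hp (i) : p i ≤ n := by
    simpa [p] using Finset.sum_le_card_nsmul Finset.univ
      (fun c => if Sum.inl (i, c) ∈ X then (1 : ℝ) else 0) 1 (by intros; split_ifs <;> simp)
  have hq (j) : q j ≤ n := by
    simpa [q] using Finset.sum_le_card_nsmul Finset.univ
      (fun r => if Sum.inr (r, j) ∈ X then (1 : ℝ) else 0) 1 (by intros; split_ifs <;> simp)
  have hX : ∑ i, p i + ∑ j, q j = X.card := by
    have h : (X.card : ℝ) = ∑ e, if e ∈ X then 1 else 0 := by simp
    rw [h, Fintype.sum_sum_type, Fintype.sum_prod_type, Fintype.sum_prod_type_right]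
  have hl : ∑ k, ((Y.filter fun e => Sum.inl (e.1, e.2 + k) ∈ X).card : ℝ) =
      ∑ e ∈ Y, p e.1 := by
    simp_rw [Finset.card_filter, Nat.cast_sum, Nat.cast_ite, Nat.cast_one, Nat.cast_zero]
    rw [Finset.sum_comm]
    exact Finset.sum_congr rfl fun e _ => Equiv.sum_comp (Equiv.addLeft e.2)
      fun c => if Sum.inl (e.1, c) ∈ X then (1 : ℝ) else 0
  have hr : ∑ k, ((Y.filter fun e => Sum.inr (e.1 + k, e.2) ∈ X).card : ℝ) =
      ∑ e ∈ Y, q e.2 := by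
    simp_rw [Finset.card_filter, Nat.cast_sum, Nat.cast_ite, Nat.cast_one, Nat.cast_zero]
    rw [Finset.sum_comm]
    exact Finset.sum_congr rfl fun e _ => Equiv.sum_comp (Equiv.addLeft e.1)
      fun r => if Sum.inr (r, e.2) ∈ X then (1 : ℝ) else 0
  have hsum := sum_add_ge_of_le (Nat.one_le_iff_ne_zero.2 (NeZero.ne n)) p q
    (fun i => Finset.sum_nonneg fun c _ => by split_ifs <;> simp) hp
    (fun j => Finset.sum_nonneg fun r _ => by split_ifs <;> simp) hq Y
  rw [hX, Finset.sum_add_distrib, ← hl, ← hr, ← Finset.sum_add_distrib] at hsum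
  have hconst (c : ℝ) : (n : ℝ) * c = ∑ _k : Fin n, c := by simp
  rw [hconst] at hsum
  obtain ⟨k, -, hk⟩ := Finset.exists_le_of_sum_le Finset.univ_nonempty hsum
  rcases le_total ((Y.filter fun e => Sum.inl (e.1, e.2 + k) ∈ X).card : ℝ)
    ((Y.filter fun e => Sum.inr (e.1 + k, e.2) ∈ X).card : ℝ) with h | h
  · exact ⟨k, _, by linarith, Or.inr rfl⟩
  · exact ⟨k, _, by linarith, Or.inl rfl⟩

/-- Grigoriev flow lower bound for `n×n` matrix multiplication over a finite field `F`:
for any set `X₁` of input entry positions (positions of `A` or of `B`) with `|X₁| = u`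
and any set `Y₁` of output positions with `|Y₁| = v`, there is an assignment `φ` of
values to the input positions outside `X₁` such that the map sending an assignment
`x : X₁ → F` of the remaining inputs to the restriction to `Y₁` of the resulting
product matrix has image of cardinality at least
`|F| ^ ((1/2)·(v − (2n² − u)²/(4n²)))`. -/
theorem stmt_7 (F : Type*) [Field F] [Fintype F] (n u v : ℕ) (hn : 1 ≤ n)
    (X₁ : Finset ((Fin n × Fin n) ⊕ (Fin n × Fin n))) (hu : X₁.card = u)
    (Y₁ : Finset (Fin n × Fin n)) (hv : Y₁.card = v) :
    ∃ φ : ((Fin n × Fin n) ⊕ (Fin n × Fin n)) → F,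
      (Fintype.card F : ℝ)
          ^ ((1 / 2 : ℝ) * ((v : ℝ) - (2 * (n : ℝ) ^ 2 - (u : ℝ)) ^ 2 / (4 * (n : ℝ) ^ 2)))
        ≤ (Nat.card (Set.range (fun x : {p // p ∈ X₁} → F =>
            fun q : {e // e ∈ Y₁} =>
              let g : ((Fin n × Fin n) ⊕ (Fin n × Fin n)) → F :=
                fun p => if h : p ∈ X₁ then x ⟨p, h⟩ else φ p
              let A : Matrix (Fin n) (Fin n) F := fun r c => g (Sum.inl (r, c))
              let B : Matrix (Fin n) (Fin n) F := fun r c => g (Sum.inr (r, c))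
              (A * B) q.1.1 q.1.2)) : ℝ) := by
  have : NeZero n := ⟨by omega⟩
  subst hu hv
  obtain ⟨k, s, hs, hk⟩ := exists_shift_card_ge X₁ Y₁
  have hφ : ∃ φ : ((Fin n × Fin n) ⊕ (Fin n × Fin n)) → F,
      Fintype.card F ^ s ≤ Nat.card (Set.range (mulSubfunction X₁ Y₁ φ)) := by
    rcases hk with rfl | rfl
    · exact exists_pow_card_left_le X₁ Y₁ k
    · exact exists_pow_card_right_le X₁ Y₁ k
  obtain ⟨φ, hφ⟩ := hφ
  refine ⟨φ, ?_⟩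
  have hF : (1 : ℝ) ≤ Fintype.card F := by exact_mod_cast Fintype.card_pos
  calc _ ≤ (Fintype.card F : ℝ) ^ (s : ℝ) := Real.rpow_le_rpow_of_exponent_le hF hs
    _ = ((Fintype.card F ^ s : ℕ) : ℝ) := by rw [Real.rpow_natCast, Nat.cast_pow]
    _ ≤ (Nat.card (Set.range (mulSubfunction X₁ Y₁ φ)) : ℝ) := Nat.cast_le.2 hφ
end

section
/- Let F be a field and suppose (u, v, w) is a bilinear algorithm with 7 multiplications computing 2×2 matrix multiplication over F; that is, u, v : Fin 7 → Matrix (Fin 2) (Fin 2) F and w : Fin 2 → Fin 2 → Fin 7 → F satisfy, for all 2×2 matrices A and B over F and all indices i, j: (A·B) i j = ∑_{l=1}^{7} w i j l · (∑_{p,q} u l p q · A p q) · (∑_{p,q} v l p q · B p q). Then for every subset S ⊆ Fin 7 there exist a subset S' ⊆ S and an injective function f assigning to each l ∈ S' a position f(l) ∈ Fin 2 × Fin 2 with u l (f l).1 (f l).2 ≠ 0, such that |S'| ≥ min(|S|, 1 + ⌈(|S| − 1)/2⌉). -/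
open Finset
open scoped Matrix

/-- A quantitative form of the marriage theorem of Hall: if every subfamily of `S` violates the
Hall condition by at most `d`, then all but `d` members of `S` have distinct representatives. -/
theorem exists_injOn_of_card_le_card_biUnion_add {ι α : Type*} [DecidableEq ι] [DecidableEq α]
    [Inhabited α] (t : ι → Finset α) (S : Finset ι) (d : ℕ)
    (h : ∀ T ⊆ S, T.card ≤ (T.biUnion t).card + d) :
    ∃ S' ⊆ S, ∃ f : ι → α, Set.InjOn f ↑S' ∧ (∀ l ∈ S', f l ∈ t l) ∧
      S.card ≤ S'.card + d := by
  let t' : S → Finset (α ⊕ Fin d) := fun l => (t l).disjSum univ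
  have hall : ∀ T : Finset S, T.card ≤ (T.biUnion t').card := by
    intro T
    rcases T.eq_empty_or_nonempty with rfl | ⟨l₀, hl₀⟩
    · simp
    have hsub : ((T.map (Function.Embedding.subtype _)).biUnion t).disjSum univ ⊆
        T.biUnion t' := by
      intro a ha
      rcases a with a | a
      · simp only [inl_mem_disjSum, mem_biUnion, mem_map] at ha
        obtain ⟨_, ⟨l, hl, rfl⟩, hla⟩ := ha
        exact mem_biUnion.2 ⟨l, hl, by simpa [t'] using hla⟩
      · exact mem_biUnion.2 ⟨l₀, hl₀, by simp [t']⟩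
    have hT := h (T.map (Function.Embedding.subtype _)) (by
      intro a ha
      obtain ⟨l, -, rfl⟩ := mem_map.1 ha
      exact l.2)
    have hcard := card_le_card hsub
    simp only [card_disjSum, card_univ, Fintype.card_fin, card_map] at hcard hT
    omega
  obtain ⟨g, hg, hgt⟩ := (all_card_le_biUnion_card_iff_exists_injective t').1 hall
  let k : ι → α ⊕ Fin d := fun l => if hl : l ∈ S then g ⟨l, hl⟩ else Sum.inl default
  have hk : Set.InjOn k S := by
    intro a ha b hb hab
    simp only [k, mem_coe.1 ha, mem_coe.1 hb, dif_pos] at hab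
    exact congrArg Subtype.val (hg hab)
  have hkt : ∀ l ∈ S, ∀ a, k l = Sum.inl a → a ∈ t l := by
    intro l hl a hla
    have := hgt ⟨l, hl⟩
    simp only [k, hl, dif_pos] at hla
    simpa [hla, t'] using this
  refine ⟨S.filter fun l => (k l).isLeft, filter_subset _ _,
    fun l => Sum.elim id (fun _ => default) (k l), ?_, ?_, ?_⟩
  · intro a ha b hb hab
    simp only [coe_filter, Set.mem_ofPred_eq, Sum.isLeft_iff] at ha hb
    obtain ⟨ha, x, hx⟩ := ha
    obtain ⟨hb, y, hy⟩ := hb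
    refine hk ha hb ?_
    simpa [hx, hy] using hab
  · intro l hl
    simp only [mem_filter, Sum.isLeft_iff] at hl
    obtain ⟨hl, x, hx⟩ := hl
    simpa [hx] using hkt l hl x hx
  · rw [← card_filter_add_card_filter_not (s := S) fun l => (k l).isLeft]
    refine Nat.add_le_add_left ?_ _
    have : ((S.filter fun l => ¬ (k l).isLeft).image k) ⊆
        (univ : Finset (Fin d)).map Function.Embedding.inr := by
      intro a ha
      obtain ⟨l, hl, rfl⟩ := mem_image.1 ha
      have hr := (mem_filter.1 hl).2
      rcases hkl : k l with x | x
      · simp [hkl] at hr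
      · simp
    have hcard := card_le_card this
    rw [card_image_of_injOn (hk.mono fun l hl => (mem_filter.1 hl).1)] at hcard
    simpa using hcard

namespace MatMulTwo

variable {F : Type*} [Field F]

/-- The linear form on `2×2` matrices with coefficient matrix `U`. -/
def pairing (U : Matrix (Fin 2) (Fin 2) F) : Matrix (Fin 2) (Fin 2) F →ₗ[F] F where
  toFun X := ∑ p, ∑ q, U p q * X p q
  map_add' X Y := by simp [Fin.sum_univ_two]; ring
  map_smul' c X := by simp [Fin.sum_univ_two]; ring

theorem pairing_apply (U X : Matrix (Fin 2) (Fin 2) F) :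
    pairing U X = ∑ p, ∑ q, U p q * X p q := rfl

theorem pairing_single (U : Matrix (Fin 2) (Fin 2) F) (p q : Fin 2) :
    pairing U (Matrix.single p q 1) = U p q := by
  fin_cases p <;> fin_cases q <;> simp [pairing_apply, Fin.sum_univ_two, Matrix.single_apply]

/-- Fewer than four linear forms on `2×2` matrices have a common nontrivial zero. -/
theorem exists_ne_zero_forall_eq_zero {ι : Type*} (s : Finset ι) (hs : s.card ≤ 3)
    (φ : ι → Matrix (Fin 2) (Fin 2) F →ₗ[F] F) :
    ∃ X ≠ 0, ∀ l ∈ s, φ l X = 0 := by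
  let L : Matrix (Fin 2) (Fin 2) F →ₗ[F] (s → F) := LinearMap.pi fun l => φ l
  have hL : LinearMap.ker L ≠ ⊥ := by
    apply LinearMap.ker_ne_bot_of_finrank_lt
    simp [Module.finrank_matrix]
    omega
  obtain ⟨X, hX, hX0⟩ := Submodule.exists_mem_ne_zero_of_ne_bot hL
  exact ⟨X, hX0, fun l hl => congrFun (LinearMap.mem_ker.1 hX) ⟨l, hl⟩⟩

theorem exists_ne_zero_of_three (φ₁ φ₂ φ₃ : Matrix (Fin 2) (Fin 2) F →ₗ[F] F) :
    ∃ X ≠ 0, φ₁ X = 0 ∧ φ₂ X = 0 ∧ φ₃ X = 0 := by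
  obtain ⟨X, hX, h⟩ := exists_ne_zero_forall_eq_zero (univ : Finset (Fin 3)) (by simp)
    ![φ₁, φ₂, φ₃]
  exact ⟨X, hX, by simpa using h 0, by simpa using h 1, by simpa using h 2⟩

/-- If the determinant vanishes on a family of `2×2` matrices and on its differences, it
vanishes on the span of the family. -/
theorem det_sum_smul_eq_zero {ι : Type*} [DecidableEq ι] (s : Finset ι) (c : ι → F)
    (B : ι → Matrix (Fin 2) (Fin 2) F)
    (h : ∀ i ∈ s, (B i).det = 0) (h' : ∀ i ∈ s, ∀ j ∈ s, i ≠ j → (B i - B j).det = 0) :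
    (∑ i ∈ s, c i • B i).det = 0 := by
  have key : ∀ r ⊆ s, (∑ i ∈ r, c i • B i).det = 0 ∧ ∀ j ∈ s, j ∉ r →
      ((∑ i ∈ r, c i • B i) + B j).det = 0 := by
    intro r
    induction r using Finset.induction_on with
    | empty => exact fun _ => ⟨by simp, fun j hj _ => by simpa using h j hj⟩
    | insert a r ha ih =>
      intro hr
      obtain ⟨h₁, h₂⟩ := ih fun x hx => hr (mem_insert_of_mem hx)
      have has := hr (mem_insert_self a r)
      have h₃ := h₂ a has ha
      have h₄ := h a has
      rw [sum_insert ha]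
      refine ⟨?_, fun j hj hjr => ?_⟩
      · simp only [Matrix.det_fin_two, Matrix.add_apply, Matrix.smul_apply, smul_eq_mul] at *
        linear_combination (1 - c a) * h₁ + c a * h₃ + (c a ^ 2 - c a) * h₄
      · have hja : j ≠ a := fun hja => hjr (hja ▸ mem_insert_self a r)
        have h₅ := h₂ j hj fun hjr' => hjr (mem_insert_of_mem hjr')
        have h₆ := h' a has j hj hja.symm
        have h₇ := h j hj
        simp only [Matrix.det_fin_two, Matrix.add_apply, Matrix.sub_apply, Matrix.smul_apply,
          smul_eq_mul] at *
        linear_combination (-c a) * h₁ + c a * h₃ + (c a ^ 2) * h₄ + h₅ - c a * h₆ + c a * h₇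
  exact (key s subset_rfl).1

variable {u v : Fin 7 → Matrix (Fin 2) (Fin 2) F} {w : Fin 2 → Fin 2 → Fin 7 → F}

/-- `(u, v, w)` is a bilinear algorithm with seven products for `2×2` matrix multiplication. -/
def IsAlgorithm (u v : Fin 7 → Matrix (Fin 2) (Fin 2) F) (w : Fin 2 → Fin 2 → Fin 7 → F) :
    Prop :=
  ∀ A B i j, (A * B) i j = ∑ l, w i j l * pairing (u l) A * pairing (v l) B

theorem IsAlgorithm.mul_eq_zero (h : IsAlgorithm u v w) {A B : Matrix (Fin 2) (Fin 2) F}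
    (hAB : ∀ l, pairing (u l) A = 0 ∨ pairing (v l) B = 0) : A * B = 0 := by
  ext i j
  rw [h, Matrix.zero_apply]
  exact sum_eq_zero fun l _ => by rcases hAB l with h | h <;> simp [h]

theorem IsAlgorithm.pairing_mul_eq_zero (h : IsAlgorithm u v w)
    {G A B : Matrix (Fin 2) (Fin 2) F}
    (hAB : ∀ l, pairing (u l) A = 0 ∨ pairing (v l) B = 0 ∨
      pairing (Matrix.of fun i j => w i j l) G = 0) : pairing G (A * B) = 0 := by
  have : pairing G (A * B) = ∑ l, pairing (Matrix.of fun i j => w i j l) G *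
      (pairing (u l) A * pairing (v l) B) := by
    simp only [pairing_apply G, h A B, pairing_apply (Matrix.of _), Fin.sum_univ_two, mul_sum,
      ← sum_add_distrib, Matrix.of_apply]
    exact sum_congr rfl fun l _ => by ring
  rw [this]
  exact sum_eq_zero fun l _ => by rcases hAB l with h | h | h <;> simp [h]

theorem card_univ_sdiff_le {T : Finset (Fin 7)} {k : ℕ} (h : 7 ≤ T.card + k) :
    (univ \ T).card ≤ k := by
  rw [card_univ_sdiff, Fintype.card_fin]
  omega

theorem eq_zero_of_two_eqs {a b c d r s : F} (h₁ : r * a + s * b = 0) (h₂ : r * c + s * d = 0)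
    (h : a * d - b * c ≠ 0) : r = 0 ∧ s = 0 := by
  refine ⟨(mul_eq_zero.1 ?_).resolve_right h, (mul_eq_zero.1 ?_).resolve_right h⟩
  · linear_combination d * h₁ - b * h₂
  · linear_combination a * h₂ - c * h₁

theorem single_mul_apply_self (i c j : Fin 2) (B : Matrix (Fin 2) (Fin 2) F) :
    (Matrix.single i c (1 : F) * B) i j = B c j := by
  simp

/-- Six left encoding matrices cannot be supported on three positions. -/
theorem IsAlgorithm.three_lt_card (h : IsAlgorithm u v w) {T : Finset (Fin 7)}
    (hT : 6 ≤ T.card) {Q : Finset (Fin 2 × Fin 2)}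
    (hQ : ∀ l ∈ T, ∀ p q, (p, q) ∉ Q → u l p q = 0) : 3 < Q.card := by
  by_contra! hQ3
  obtain ⟨⟨i, c⟩, hic⟩ : ∃ x, x ∉ Q := by
    by_contra! hall
    have := card_le_card (fun x _ => hall x : (univ : Finset (Fin 2 × Fin 2)) ⊆ Q)
    simp at this
    omega
  obtain ⟨l₀, hl₀⟩ : ∃ l₀, univ \ T ⊆ {l₀} :=
    card_le_one_iff_subset_singleton.1 (card_univ_sdiff_le (by omega))
  obtain ⟨B, hB, h₁, h₂, h₃⟩ := exists_ne_zero_of_three (pairing (v l₀))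
    (pairing (Matrix.single (1 - c) 0 1)) (pairing (Matrix.single (1 - c) 1 1))
  have hAB := h.mul_eq_zero (A := Matrix.single i c 1) (B := B) fun l => by
    by_cases hl : l ∈ T
    · exact Or.inl (by rw [pairing_single]; exact hQ l hl _ _ hic)
    · have : l = l₀ := by simpa using hl₀ (by simpa using hl : l ∈ univ \ T)
      exact Or.inr (this ▸ h₁)
  have hc : ∀ j, B c j = 0 := fun j => by
    exact (single_mul_apply_self i c j B).symm.trans (congrFun (congrFun hAB i) j)
  refine hB ?_
  ext p q
  fin_cases c <;> fin_cases p <;> fin_cases q <;>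
    simp_all [pairing_apply, Fin.sum_univ_two, Matrix.single_apply]

/-- Four left encoding matrices cannot be supported on two positions. -/
theorem IsAlgorithm.two_lt_card (h : IsAlgorithm u v w) {T : Finset (Fin 7)}
    (hT : 4 ≤ T.card) {Q : Finset (Fin 2 × Fin 2)}
    (hQ : ∀ l ∈ T, ∀ p q, (p, q) ∉ Q → u l p q = 0) : 2 < Q.card := by
  by_contra! hQ2
  have hR : (univ \ T).card ≤ 3 := card_univ_sdiff_le (by omega)
  by_cases hcol : ∀ c, ∃ i, (i, c) ∉ Q
  · obtain ⟨B, hB, hvB⟩ := exists_ne_zero_forall_eq_zero _ hR fun l => pairing (v l)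
    refine hB ?_
    ext c j
    obtain ⟨i, hi⟩ := hcol c
    have hAB := h.mul_eq_zero (A := Matrix.single i c 1) (B := B) fun l => by
      by_cases hl : l ∈ T
      · exact Or.inl (by rw [pairing_single]; exact hQ l hl _ _ hi)
      · exact Or.inr (hvB l (by simpa using hl))
    exact (single_mul_apply_self i c j B).symm.trans (congrFun (congrFun hAB i) j)
  · push Not at hcol
    obtain ⟨c, hc⟩ := hcol
    have hQc : Q = {(0, c), (1, c)} := by
      refine (eq_of_subset_of_card_le ?_ ?_).symm
      · intro x hx
        simp only [mem_insert, mem_singleton] at hx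
        rcases hx with rfl | rfl <;> exact hc _
      · rwa [card_pair (by simp)]
    obtain ⟨G, hG, hwG⟩ := exists_ne_zero_forall_eq_zero _ hR fun l =>
      pairing (Matrix.of fun i j => w i j l)
    refine hG ?_
    ext i j
    have hAB := h.pairing_mul_eq_zero (G := G) (A := Matrix.single i (1 - c) 1)
      (B := Matrix.single (1 - c) j 1) fun l => by
        by_cases hl : l ∈ T
        · refine Or.inl ?_
          rw [pairing_single]
          refine hQ l hl _ _ ?_
          rw [hQc]
          fin_cases c <;> simp
        · exact Or.inr (Or.inr (hwG l (by simpa using hl)))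
    rwa [Matrix.single_mul_single_same, mul_one, pairing_single] at hAB

theorem pairing_vecMulVec (U : Matrix (Fin 2) (Fin 2) F) (x r : Fin 2 → F) :
    pairing U (Matrix.vecMulVec x r) = r 0 * (x ᵥ* U) 0 + r 1 * (x ᵥ* U) 1 := by
  simp only [pairing_apply, Matrix.vecMulVec_apply, Matrix.vecMul, dotProduct, Fin.sum_univ_two]
  ring

theorem pairing_vecMulVec_single (U : Matrix (Fin 2) (Fin 2) F) (y : Fin 2 → F) (i : Fin 2) :
    pairing U (Matrix.vecMulVec (Pi.single i 1) y) = (U *ᵥ y) i := by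
  fin_cases i <;> simp [pairing_apply, Matrix.vecMulVec_apply, Matrix.mulVec, dotProduct]

theorem pairing_comm (U X : Matrix (Fin 2) (Fin 2) F) : pairing U X = pairing X U := by
  simp only [pairing_apply, mul_comm]

/-- A matrix whose rows satisfy a nontrivial linear relation `y` has columns proportional to the
vector orthogonal to `y`. -/
theorem exists_eq_vecMulVec {y : Fin 2 → F} (hy : y ≠ 0) {B : Matrix (Fin 2) (Fin 2) F}
    (hB : y ᵥ* B = 0) : ∃ r, B = Matrix.vecMulVec ![y 1, -y 0] r := by
  have hB₀ : ∀ q, y 0 * B 0 q + y 1 * B 1 q = 0 := fun q => by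
    simpa [Matrix.vecMul, dotProduct, Fin.sum_univ_two] using congrFun hB q
  by_cases hy0 : y 0 = 0
  · have hy1 : y 1 ≠ 0 := fun hy1 => hy (by ext i; fin_cases i <;> simp [hy0, hy1])
    refine ⟨fun q => B 0 q / y 1, ?_⟩
    ext p q
    have := hB₀ q
    fin_cases p <;> simp_all [Matrix.vecMulVec_apply]
    field_simp
  · refine ⟨fun q => -B 1 q / y 0, ?_⟩
    ext p q
    have := hB₀ q
    fin_cases p <;> simp [Matrix.vecMulVec_apply] <;> field_simp
    linear_combination this

/-- If the only common zero in `F²` of a family of linear forms is the origin, two of the forms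
are linearly independent. -/
theorem exists_minor_ne_zero {ι : Type*} (P : ι → Prop) (a : ι → Fin 2 → F)
    (ha : ∀ r : Fin 2 → F, (∀ m, P m → r 0 * a m 0 + r 1 * a m 1 = 0) → r = 0) :
    ∃ m n, P m ∧ P n ∧ a m 1 * a n 0 - a m 0 * a n 1 ≠ 0 := by
  by_contra! hcon
  have hzero : ∀ m, P m → a m 0 = 0 ∧ a m 1 = 0 := fun m hm => by
    have := ha ![a m 1, -a m 0] fun n hn => by simpa [sub_eq_add_neg] using hcon m n hm hn
    exact ⟨by simpa using congrFun this 1, by simpa using congrFun this 0⟩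
  have := ha (Pi.single 0 1) fun m hm => by simp [hzero m hm]
  simp at this

/-- Two left encoding matrices that annihilate a common vector `y` cannot both vanish on a
matrix `A₀` that does not annihilate the vector orthogonal to `y`. -/
theorem IsAlgorithm.false_of_mulVec_eq_zero (h : IsAlgorithm u v w) {l l' : Fin 7} (hl : l ≠ l')
    {y : Fin 2 → F} (hy : y ≠ 0) (hul : u l *ᵥ y = 0) (hul' : u l' *ᵥ y = 0)
    {A₀ : Matrix (Fin 2) (Fin 2) F} (hA₀ : A₀ *ᵥ ![y 1, -y 0] ≠ 0)
    (h₀ : pairing (u l) A₀ = 0) (h₀' : pairing (u l') A₀ = 0) : False := by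
  obtain ⟨x, hx⟩ : ∃ x : Fin 2 → F, x = ![y 1, -y 0] := ⟨_, rfl⟩
  rw [← hx] at hA₀
  have hker : ∀ r, (∀ m, m ≠ l → m ≠ l' → pairing (v m) (Matrix.vecMulVec x r) = 0) →
      r = 0 := by
    intro r hr
    have hAB := h.mul_eq_zero (A := A₀) (B := Matrix.vecMulVec x r) fun k => by
      by_cases hk : k = l
      · exact Or.inl (hk ▸ h₀)
      by_cases hk' : k = l'
      · exact Or.inl (hk' ▸ h₀')
      exact Or.inr (hr k hk hk')
    rw [Matrix.mul_vecMulVec] at hAB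
    exact (Matrix.vecMulVec_eq_zero.1 hAB).resolve_left hA₀
  obtain ⟨m, n, ⟨hml, hml'⟩, ⟨hnl, hnl'⟩, hn⟩ := exists_minor_ne_zero
    (fun m => m ≠ l ∧ m ≠ l') (fun m => x ᵥ* v m) fun r hr => hker r fun m hm hm' => by
      rw [pairing_vecMulVec]
      exact hr m ⟨hm, hm'⟩
  have hmn : m ≠ n := by
    rintro rfl
    exact hn (by ring)
  have hR : (univ \ {l, l', m, n} : Finset (Fin 7)).card ≤ 3 := by
    apply card_univ_sdiff_le
    rw [card_insert_of_notMem, card_insert_of_notMem, card_pair hmn] <;>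
      simp [hl, hml.symm, hnl.symm, hml'.symm, hnl'.symm]
  obtain ⟨G, hG, hwG⟩ := exists_ne_zero_forall_eq_zero _ hR fun k =>
    pairing (Matrix.of fun i j => w i j k)
  refine hG ?_
  ext i j
  obtain ⟨B, hB, hmB, hnB, hyB⟩ := exists_ne_zero_of_three (pairing (v m)) (pairing (v n))
    (pairing (Matrix.vecMulVec y (Pi.single (1 - j) 1)))
  have hAB := h.pairing_mul_eq_zero (G := G) (A := Matrix.vecMulVec (Pi.single i 1) y)
    (B := B) fun k => by
      by_cases hk : k ∈ ({l, l', m, n} : Finset (Fin 7))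
      · simp only [mem_insert, mem_singleton] at hk
        rcases hk with rfl | rfl | rfl | rfl
        · exact Or.inl (by rw [pairing_vecMulVec_single, hul, Pi.zero_apply])
        · exact Or.inl (by rw [pairing_vecMulVec_single, hul', Pi.zero_apply])
        · exact Or.inr (Or.inl hmB)
        · exact Or.inr (Or.inl hnB)
      · exact Or.inr (Or.inr (hwG k (by simpa using hk)))
  rw [pairing_comm, pairing_vecMulVec] at hyB
  rw [Matrix.vecMulVec_mul, pairing_vecMulVec_single] at hAB
  have hyB' : (y ᵥ* B) (1 - j) = 0 := by
    fin_cases j <;> simpa using hyB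
  have hGj : G i j * (y ᵥ* B) j = 0 := by
    simp only [Matrix.mulVec, dotProduct, Fin.sum_univ_two] at hAB
    obtain rfl | rfl : j = 0 ∨ j = 1 := by omega
    · rw [sub_zero] at hyB'
      linear_combination hAB - G i 1 * hyB'
    · rw [sub_self] at hyB'
      linear_combination hAB - G i 0 * hyB'
  refine (_root_.mul_eq_zero.1 hGj).resolve_right fun hj => hB ?_
  obtain ⟨r, rfl⟩ := exists_eq_vecMulVec hy (B := B) (by
    ext q
    obtain rfl | rfl : q = j ∨ q = 1 - j := by omega
    · exact hj
    · exact hyB')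
  rw [← hx, pairing_vecMulVec] at hmB hnB
  obtain ⟨hr₀, hr₁⟩ := eq_zero_of_two_eqs hmB hnB (by
    contrapose! hn
    linear_combination -hn)
  ext p q
  fin_cases q <;> simp [Matrix.vecMulVec_apply, hr₀, hr₁]

/-- If one left encoding matrix vanishes, all others are invertible. -/
theorem IsAlgorithm.det_ne_zero_of_eq_zero (h : IsAlgorithm u v w) {l l' : Fin 7} (hl : l ≠ l')
    (hul : u l = 0) : (u l').det ≠ 0 := by
  intro hdet
  obtain ⟨y, hy, hul'⟩ := Matrix.exists_mulVec_eq_zero_iff.2 hdet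
  obtain ⟨i, hi⟩ := Function.ne_iff.1 hy
  obtain ⟨A₀, hA₀, h₁, h₂, h₃⟩ := exists_ne_zero_of_three (pairing (u l'))
    (pairing (Matrix.single 0 i 1)) (pairing (Matrix.single 1 i 1))
  refine h.false_of_mulVec_eq_zero hl hy (by simp [hul]) hul' (A₀ := A₀) ?_
    (by simp [hul, pairing_apply]) h₁
  intro h0
  have e₀ := congrFun h0 0
  have e₁ := congrFun h0 1
  refine hA₀ ?_
  ext p q
  fin_cases i <;> fin_cases p <;> fin_cases q <;>
    simp_all [pairing_apply, Fin.sum_univ_two, Matrix.single_apply, Matrix.mulVec, dotProduct]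

/-- If `u l = 0`, then an invertible matrix lies off the kernel of at least three of the forms
`v k`, where `l` and any one other index are disregarded. -/
theorem IsAlgorithm.det_eq_zero_of_eq_zero (h : IsAlgorithm u v w) {l : Fin 7} (hul : u l = 0)
    (l' i j : Fin 7) {B : Matrix (Fin 2) (Fin 2) F}
    (hB : ∀ k, k ≠ l → k ≠ l' → k ≠ i → k ≠ j → pairing (v k) B = 0) : B.det = 0 := by
  by_contra hdet
  obtain ⟨A, hA, h₁, h₂, h₃⟩ := exists_ne_zero_of_three (pairing (u l')) (pairing (u i))
    (pairing (u j))
  have hAB := h.mul_eq_zero (A := A) (B := B) fun k => by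
    by_cases hk : k = l
    · exact Or.inl (by simp [hk, hul, pairing_apply])
    by_cases hk' : k = l'
    · exact Or.inl (hk' ▸ h₁)
    by_cases hki : k = i
    · exact Or.inl (hki ▸ h₂)
    by_cases hkj : k = j
    · exact Or.inl (hkj ▸ h₃)
    exact Or.inr (hB k hk hk' hki hkj)
  refine hA ?_
  rw [← Matrix.mul_nonsing_inv_cancel_right B A (isUnit_iff_ne_zero.2 hdet), hAB, zero_mul]

/-- If `u l = 0`, then a nonzero matrix lies off the kernel of at least two of the forms
`v k`, where `l` and any one other index are disregarded. -/
theorem IsAlgorithm.eq_zero_of_eq_zero (h : IsAlgorithm u v w) {l l' : Fin 7} (hl : l ≠ l')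
    (hul : u l = 0) (i : Fin 7) {B : Matrix (Fin 2) (Fin 2) F}
    (hB : ∀ k, k ≠ l → k ≠ l' → k ≠ i → pairing (v k) B = 0) : B = 0 := by
  by_contra hB0
  have hdet := h.det_ne_zero_of_eq_zero hl hul
  obtain ⟨q, j, hqj⟩ : ∃ q j, B q j ≠ 0 := by
    by_contra! hcon
    exact hB0 (by ext q j; exact hcon q j)
  have hx : u l' *ᵥ ![B 1 j, -B 0 j] ≠ 0 := fun h0 => by
    have := Matrix.eq_zero_of_mulVec_eq_zero hdet h0
    have e₀ := congrFun this 0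
    have e₁ := congrFun this 1
    fin_cases q <;> simp_all
  obtain ⟨p, hp⟩ := Function.ne_iff.1 hx
  obtain ⟨A, hA, h₁, h₂, h₃⟩ := exists_ne_zero_of_three (pairing (u l')) (pairing (u i))
    (pairing (Matrix.single (1 - p) (1 - q) 1))
  have hAB := h.mul_eq_zero (A := A) (B := B) fun k => by
    by_cases hk : k = l
    · exact Or.inl (by simp [hk, hul, pairing_apply])
    by_cases hk' : k = l'
    · exact Or.inl (hk' ▸ h₁)
    by_cases hki : k = i
    · exact Or.inl (hki ▸ h₂)
    exact Or.inr (hB k hk hk' hki)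
  have hrow : ∀ a, A a 0 * B 0 j + A a 1 * B 1 j = 0 := fun a => by
    simpa [Matrix.mul_apply, Fin.sum_univ_two] using congrFun (congrFun hAB a) j
  have hA₁ : A (1 - p) (1 - q) = 0 := by
    fin_cases p <;> fin_cases q <;>
      simpa [pairing_apply, Fin.sum_univ_two, Matrix.single_apply] using h₃
  have hA₂ : A (1 - p) q = 0 := by
    have := hrow (1 - p)
    fin_cases q <;> simp_all
  have hA₃ : ∀ b, A (1 - p) b = 0 := fun b => by
    fin_cases q <;> fin_cases b <;> simp_all
  have hA₄ : A p 0 * u l' p 0 + A p 1 * u l' p 1 = 0 := by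
    have e₀ := hA₃ 0
    have e₁ := hA₃ 1
    fin_cases p <;> simp_all [pairing_apply, Fin.sum_univ_two, mul_comm]
  obtain ⟨hp₀, hp₁⟩ := eq_zero_of_two_eqs hA₄ (hrow p) (by
    simpa [Matrix.mulVec, dotProduct, Fin.sum_univ_two, sub_eq_add_neg] using hp)
  refine hA ?_
  ext a b
  have e₀ := hA₃ 0
  have e₁ := hA₃ 1
  fin_cases p <;> fin_cases a <;> fin_cases b <;> simp_all

/-- The left encoding matrices are nonzero. -/
theorem IsAlgorithm.ne_zero (h : IsAlgorithm u v w) (l : Fin 7) : u l ≠ 0 := by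
  intro hul
  obtain ⟨l', o, hl, hol, hol'⟩ : ∃ l' o : Fin 7, l ≠ l' ∧ o ≠ l ∧ o ≠ l' :=
    ⟨l + 1, l + 2, by omega, by omega, by omega⟩
  have hex : ∀ i, ∃ B, i ∉ ({l, l', o} : Finset (Fin 7)) → pairing (v o) B = 1 ∧
      pairing (v i) B ≠ 0 ∧ ∀ k, k ≠ l → k ≠ l' → k ≠ o → k ≠ i → pairing (v k) B = 0 := by
    intro i
    by_cases hi : i ∈ ({l, l', o} : Finset (Fin 7))
    · exact ⟨0, fun hi' => absurd hi hi'⟩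
    have hcard : (univ \ insert i {l, l', o} : Finset (Fin 7)).card ≤ 3 := by
      apply card_univ_sdiff_le
      rw [card_insert_of_notMem hi, card_insert_of_notMem, card_pair hol'.symm]
      simp [hl, hol.symm]
    obtain ⟨B, hB, hvB⟩ := exists_ne_zero_forall_eq_zero _ hcard fun k => pairing (v k)
    have hz : ∀ k, k ≠ l → k ≠ l' → k ≠ o → k ≠ i → pairing (v k) B = 0 :=
      fun k h₁ h₂ h₃ h₄ => hvB k (by simp [h₁, h₂, h₃, h₄])
    have hoB : pairing (v o) B ≠ 0 := fun h0 => hB <|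
      h.eq_zero_of_eq_zero hl hul i fun k h₁ h₂ h₃ => by
        by_cases hk : k = o
        · exact hk ▸ h0
        · exact hz k h₁ h₂ hk h₃
    have hiB : pairing (v i) B ≠ 0 := fun h0 => hB <|
      h.eq_zero_of_eq_zero hl hul o fun k h₁ h₂ h₃ => by
        by_cases hk : k = i
        · exact hk ▸ h0
        · exact hz k h₁ h₂ h₃ hk
    refine ⟨(pairing (v o) B)⁻¹ • B, fun _ => ⟨by simp [hoB], by simp [hoB, hiB], ?_⟩⟩
    intro k h₁ h₂ h₃ h₄
    simp [hz k h₁ h₂ h₃ h₄]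
  choose B hB using hex
  let R : Finset (Fin 7) := univ \ {l, l', o}
  have hR : ∀ i ∈ R, i ∉ ({l, l', o} : Finset (Fin 7)) := fun i hi => (mem_sdiff.1 hi).2
  let c : Fin 7 → F := fun i => pairing (v i) 1 / pairing (v i) (B i)
  have hdet : (∑ i ∈ R, c i • B i).det = 0 := by
    apply det_sum_smul_eq_zero
    · intro i hi
      exact h.det_eq_zero_of_eq_zero hul l' o i fun k => (hB i (hR i hi)).2.2 k
    · intro i hi j hj _
      refine h.det_eq_zero_of_eq_zero hul l' i j fun k h₁ h₂ h₃ h₄ => ?_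
      rw [map_sub]
      by_cases hk : k = o
      · rw [hk, (hB i (hR i hi)).1, (hB j (hR j hj)).1, sub_self]
      · rw [(hB i (hR i hi)).2.2 k h₁ h₂ hk h₃, (hB j (hR j hj)).2.2 k h₁ h₂ hk h₄, sub_self]
  have hone : 1 - ∑ i ∈ R, c i • B i = 0 :=
    h.eq_zero_of_eq_zero hl hul o fun k h₁ h₂ h₃ => by
      have hk : k ∈ R := by simp [R, h₁, h₂, h₃]
      rw [map_sub, map_sum, sum_eq_single_of_mem k hk]
      · simp [c, (hB k (hR k hk)).2.1]
      · intro i hi hik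
        simp [(hB i (hR i hi)).2.2 k h₁ h₂ h₃ hik.symm]
  rw [← sub_eq_zero.1 hone] at hdet
  simp at hdet

/-- Two left encoding matrices cannot be supported on the same position. -/
theorem IsAlgorithm.one_lt_card (h : IsAlgorithm u v w) {T : Finset (Fin 7)}
    (hT : 2 ≤ T.card) {Q : Finset (Fin 2 × Fin 2)}
    (hQ : ∀ l ∈ T, ∀ p q, (p, q) ∉ Q → u l p q = 0) : 1 < Q.card := by
  by_contra! hQ1
  obtain ⟨⟨p, q⟩, hpq⟩ := card_le_one_iff_subset_singleton.1 hQ1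
  obtain ⟨l, hl, l', hl', hll⟩ := Finset.one_lt_card.1 (show 1 < T.card by omega)
  have hu : ∀ k ∈ T, ∀ a b, (a, b) ≠ (p, q) → u k a b = 0 := fun k hk a b hab =>
    hQ k hk a b fun hmem => hab (by simpa using hpq hmem)
  have hmul : ∀ k ∈ T, u k *ᵥ Pi.single (1 - q) 1 = 0 := fun k hk => by
    ext a
    rw [Matrix.mulVec_single_one]
    exact hu k hk _ _ (by fin_cases q <;> simp)
  have hpair : ∀ k ∈ T, pairing (u k) (Matrix.single (1 - p) q 1) = 0 := fun k hk => by
    rw [pairing_single]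
    exact hu k hk _ _ (by fin_cases p <;> simp)
  refine h.false_of_mulVec_eq_zero hll (by simp) (hmul l hl) (hmul l' hl') ?_
    (hpair l hl) (hpair l' hl')
  intro h0
  have := congrFun h0 (1 - p)
  fin_cases p <;> fin_cases q <;> simp [Matrix.mulVec, dotProduct, Matrix.single_apply] at this

end MatMulTwo

open MatMulTwo

/-- Hopcroft–Kerr type property of the encoder of any bilinear algorithm computing
`2×2` matrix multiplication with 7 multiplications: for every subset `S` of the 7
products there are a subset `S' ⊆ S` with `|S'| ≥ min(|S|, 1 + ⌈(|S|−1)/2⌉)` and an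
injective choice, for each `l ∈ S'`, of a position where the left encoding matrix
`u l` is nonzero. (For naturals, `min(s, 1 + ⌈(s−1)/2⌉) = min(s, 1 + s/2)` with
natural-number division.) -/
theorem stmt_8 (F : Type*) [Field F]
    (u v : Fin 7 → Matrix (Fin 2) (Fin 2) F) (w : Fin 2 → Fin 2 → Fin 7 → F)
    (halg : ∀ A B : Matrix (Fin 2) (Fin 2) F, ∀ i j : Fin 2,
      (A * B) i j
        = ∑ l, w i j l * (∑ p, ∑ q, u l p q * A p q) * (∑ p, ∑ q, v l p q * B p q)) :
    ∀ S : Finset (Fin 7), ∃ S' : Finset (Fin 7), S' ⊆ S ∧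
      ∃ f : Fin 7 → Fin 2 × Fin 2,
        Set.InjOn f ↑S' ∧ (∀ l ∈ S', u l (f l).1 (f l).2 ≠ 0) ∧
        min S.card (1 + S.card / 2) ≤ S'.card := by
  classical
  have h : IsAlgorithm u v w := halg
  intro S
  let t : Fin 7 → Finset (Fin 2 × Fin 2) := fun l => univ.filter fun x => u l x.1 x.2 ≠ 0
  obtain ⟨S', hS', f, hf, hft, hcard⟩ := exists_injOn_of_card_le_card_biUnion_add t S
    (S.card - min S.card (1 + S.card / 2)) (by
      intro T hTS
      have hQ : ∀ l ∈ T, ∀ p q, (p, q) ∉ T.biUnion t → u l p q = 0 := by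
        intro l hl p q hpq
        by_contra hne
        exact hpq (mem_biUnion.2 ⟨l, hl, by simpa [t] using hne⟩)
      have h₁ : 1 ≤ T.card → 0 < (T.biUnion t).card := by
        intro hT
        obtain ⟨l, hl⟩ := card_pos.1 hT
        by_contra! h0
        refine h.ne_zero l ?_
        ext p q
        exact hQ l hl p q (by simp [card_eq_zero.1 (Nat.le_zero.1 h0)])
      have h₂ := fun hT => h.one_lt_card (T := T) hT hQ
      have h₃ := fun hT => h.two_lt_card (T := T) hT hQ
      have h₄ := fun hT => h.three_lt_card (T := T) hT hQ
      have := card_le_card hTS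
      have : S.card ≤ 7 := by simpa using card_le_univ S
      omega)
  exact ⟨S', hS', f, hf, fun l hl => (mem_filter.1 (hft l hl)).2, by omega⟩
end
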